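/- The map ψ sending a semistandard Young tableau b to the multisegment M_b containing one segment [i,j] for each entry j ≥ i in row i of b satisfies ψ(e_i(b)) = e_i(ψ(b)) for every tableau b and every i such that e_i(b) ≠ 0; i.e., ψ is a weak embedding of crystals from SSYT_n(λ) into MS_n. -/

import Mathlib

/-- A segment `[a,b]` is a pair of integers. -/
abbrev Seg : Type := ℕ × ℕ

/-- A multisegment is a finite multiset of segments. -/
abbrev MS : Type := Multiset Seg

/-- `M ∈ MS_n`: all segments `[a,b]` satisfy `1 ≤ a ≤ b ≤ n`. -/
def IsMS (n : ℕ) (M : MS) : Prop := ∀ s ∈ M, 1 ≤ s.1 ∧ s.1 ≤ s.2 ∧ s.2 ≤ n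

/-- A bracket: `op` = "(", `cl` = ")". -/
inductive Br | op | cl
deriving DecidableEq

/-- One step of the left-to-right bracket cancellation procedure.  The state
`(cls, ops)` records the tags of the currently uncanceled ")" (in order) and the
currently uncanceled "(" (in order).  A new "(" is appended to `ops`; a new ")"
cancels the last uncanceled "(" if there is one, and otherwise is appended to `cls`. -/
def step {τ : Type} : (List τ × List τ) → (Br × τ) → (List τ × List τ)
  | (cls, ops), (Br.op, s) => (cls, ops ++ [s])
  | (cls, ops), (Br.cl, s) => if ops.isEmpty then (cls ++ [s], ops) else (cls, ops.dropLast)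

/-- Process a tagged bracket string; the result `(cls, ops)` lists the tags of the
uncanceled ")" and the uncanceled "(" (left to right).  The reduced (uncanceled)
string is `")"^cls.length ++ "("^ops.length`. -/
def scan {τ : Type} (l : List (Br × τ)) : List τ × List τ := l.foldl step ([], [])

/-- Number of uncanceled ")" in a tagged bracket string. -/
def urStr {τ : Type} (l : List (Br × τ)) : ℕ := (scan l).1.length

/-- Number of uncanceled "(" in a tagged bracket string. -/
def epsStr {τ : Type} (l : List (Br × τ)) : ℕ := (scan l).2.length

/-- Tag of the rightmost uncanceled ")", if any. -/
def lastCl {τ : Type} (l : List (Br × τ)) : Option τ := (scan l).1.getLast?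

/-- Tag of the leftmost uncanceled "(", if any. -/
def headOp {τ : Type} (l : List (Br × τ)) : Option τ := (scan l).2.head?

/-- The string `S_i(M)`: segments are ordered by increasing height, then by
decreasing lower endpoint; each `[h,i]` contributes "(" and each `[h,i-1]`
contributes ")".  In the block of segments of height `t` the "(" over the
`[i-t+1, i]` segments come immediately before the ")" over the `[i-t, i-1]`
segments, and blocks appear for `t = 1, 2, …`. -/
def Si (M : MS) (i : ℕ) : List (Br × Seg) :=
  (List.range i).flatMap fun t0 =>
    let t := t0 + 1
    List.replicate (M.count (i - t + 1, i)) (Br.op, ((i - t + 1 : ℕ), i)) ++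
    List.replicate (M.count (i - t, i - 1)) (Br.cl, ((i - t : ℕ), i - 1))

/-- The string `S_i^*(M)`: segments ordered by increasing height, then by
increasing lower endpoint; each `[i,j]` contributes "(" and each `[i+1,j]`
contributes ")".  In the block of height `t` the "(" below the `[i, i+t-1]`
segments come immediately before the ")" below the `[i+1, i+t]` segments. -/
def SiStar (n : ℕ) (M : MS) (i : ℕ) : List (Br × Seg) :=
  (List.range n).flatMap fun t0 =>
    let t := t0 + 1
    List.replicate (M.count (i, i + t - 1)) (Br.op, (i, i + t - 1)) ++
    List.replicate (M.count (i + 1, i + t)) (Br.cl, (i + 1, i + t))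

/-- The crystal operator `f_i` on multisegments: it changes the segment `[h,i-1]`
under the rightmost uncanceled ")" of `S_i(M)` into `[h,i]`, or adds a new
segment `[i,i]` if there is no uncanceled ")". -/
def fM (i : ℕ) (M : MS) : MS :=
  match lastCl (Si M i) with
  | some s => M.erase s + {(s.1, i)}
  | none => M + {(i, i)}

/-- The crystal operator `e_i` on multisegments: it changes the segment `[h,i]`
under the leftmost uncanceled "(" of `S_i(M)` into `[h,i-1]` (deleting it when
`h = i`), or returns `none` (i.e. `0`) if there is no uncanceled "(". -/
def eM (i : ℕ) (M : MS) : Option MS :=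
  match headOp (Si M i) with
  | some s => some (if s.1 = i then M.erase s else M.erase s + {(s.1, i - 1)})
  | none => none

/-- The operator `f_i^*`: it changes the segment `[i+1,j]` under the rightmost
uncanceled ")" of `S_i^*(M)` into `[i,j]`, or adds `[i,i]` if there is none. -/
def fMStar (n i : ℕ) (M : MS) : MS :=
  match lastCl (SiStar n M i) with
  | some s => M.erase s + {(i, s.2)}
  | none => M + {(i, i)}

/-- The operator `e_i^*`: it changes the segment `[i,j]` under the leftmost
uncanceled "(" of `S_i^*(M)` into `[i+1,j]` (deleting it when `j = i`), or
returns `none` if there is no uncanceled "(". -/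
def eMStar (n i : ℕ) (M : MS) : Option MS :=
  match headOp (SiStar n M i) with
  | some s => some (if s.2 = i then M.erase s else M.erase s + {(i + 1, s.2)})
  | none => none

/-- The number of boxes labeled `j` in `M`: each segment `[a,b]` contains one
box labeled `j` for each `a ≤ j ≤ b`. -/
def boxes (M : MS) (j : ℕ) : ℕ :=
  (M.filter (fun s => s.1 ≤ j ∧ j ≤ s.2)).card

/-- The pairing `⟨wt(M), α_i^∨⟩ = #(boxes i-1) + #(boxes i+1) - 2 #(boxes i)`. -/
def wtPair (M : MS) (i : ℕ) : ℤ :=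
  (boxes M (i - 1) : ℤ) + (boxes M (i + 1) : ℤ) - 2 * (boxes M i : ℤ)

/-- The multisegment `M_b` associated to a (tableau) filling `f` of the Young
diagram `μ`: one segment `[r+1, f(r,c)]` for each cell `(r,c)` (rows indexed
from `0`, so cell row `r` is row `r+1` of the paper) whose entry is `≥ r+1`. -/
def psiMS (μ : YoungDiagram) (f : ℕ → ℕ → ℕ) : MS :=
  (μ.cells.val.filter (fun c => c.1 + 1 ≤ f c.1 c.2)).map (fun c => (c.1 + 1, f c.1 c.2))

/-- Does column `j` of the filling `f` of `μ` contain the value `v`?  (The cells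
of column `j` are the `(r, j)` with `r < μ.colLen j`.) -/
def colHasB (μ : YoungDiagram) (f : ℕ → ℕ → ℕ) (j v : ℕ) : Bool :=
  (List.range (μ.colLen j)).any (fun r => f r j == v)

/-- The tableau bracket string for index `i`: reading columns left to right, a
"(" above each column containing `i` but not `i-1`, and a ")" above each column
containing `i-1` but not `i`; brackets are tagged by their column. -/
def tabString (μ : YoungDiagram) (f : ℕ → ℕ → ℕ) (i : ℕ) : List (Br × ℕ) :=
  (List.range (μ.rowLen 0)).flatMap fun j =>
    if colHasB μ f j i && !colHasB μ f j (i - 1) then [(Br.op, j)]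
    else if colHasB μ f j (i - 1) && !colHasB μ f j i then [(Br.cl, j)]
    else []

/-- The tableau crystal operator `e_i`: change the `i` in the column of the
leftmost uncanceled "(" to `i-1`; return `none` if there is no uncanceled "(". -/
def eTab (μ : YoungDiagram) (f : ℕ → ℕ → ℕ) (i : ℕ) : Option (ℕ → ℕ → ℕ) :=
  match headOp (tabString μ f i) with
  | none => none
  | some j =>
      some (fun r c => if c = j ∧ f r c = i ∧ (r, c) ∈ μ.cells then i - 1 else f r c)

/-- The effect of one bracket on the list of uncanceled "(". -/
def openStep {τ : Type} (ops : List τ) : Br × τ → List τ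
  | (Br.op, s) => ops ++ [s]
  | (Br.cl, _) => ops.dropLast

theorem scan_snd {τ : Type} (l : List (Br × τ)) : (scan l).2 = l.foldl openStep [] := by
  suffices h : ∀ st : List τ × List τ, (l.foldl step st).2 = l.foldl openStep st.2 from h _
  induction l with
  | nil => intro st; rfl
  | cons b l ih =>
    intro st
    obtain ⟨cls, ops⟩ := st
    obtain ⟨_ | _, s⟩ := b
    · exact ih _
    · rw [List.foldl_cons, List.foldl_cons, ih]
      cases ops <;> rfl

theorem map_foldl_openStep {τ σ : Type} (h : τ → σ) (l : List (Br × τ)) (ops : List τ) :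
    (l.foldl openStep ops).map h =
      (l.map (Prod.map id h)).foldl openStep (ops.map h) := by
  induction l generalizing ops with
  | nil => rfl
  | cons b l ih =>
    rw [List.foldl_cons, ih, List.map_cons, List.foldl_cons]
    obtain ⟨_ | _, s⟩ := b <;> simp [openStep, List.map_dropLast]

theorem mem_of_mem_foldl_openStep {τ : Type} {l : List (Br × τ)} {ops : List τ} {s : τ}
    (hs : s ∈ l.foldl openStep ops) : s ∈ ops ∨ (Br.op, s) ∈ l := by
  induction l generalizing ops with
  | nil => exact Or.inl hs
  | cons b l ih =>
    rcases ih hs with h | h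
    · obtain ⟨_ | _, x⟩ := b
      · simp only [openStep, List.mem_append, List.mem_singleton] at h
        rcases h with h | rfl
        · exact Or.inl h
        · simp
      · exact Or.inl (List.mem_of_mem_dropLast h)
    · exact Or.inr (List.mem_cons_of_mem _ h)

theorem foldl_openStep_replicate {τ : Type} (p q : ℕ) (s s' : τ) (ops : List τ) :
    (List.replicate p (Br.op, s) ++ List.replicate q (Br.cl, s')).foldl openStep ops =
      List.dropLast^[q] (ops ++ List.replicate p s) := by
  have hcl : ∀ ops : List τ,
      (List.replicate q (Br.cl, s')).foldl openStep ops = List.dropLast^[q] ops := by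
    induction q with
    | zero => intro ops; rfl
    | succ q ih => intro ops; exact ih _
  rw [List.foldl_append, hcl]
  congr 1
  induction p generalizing ops with
  | zero => simp
  | succ p ih => rw [List.replicate_succ, List.foldl_cons, ih]; simp [openStep, List.replicate_succ]

/-- The brackets above a column `j`, where `P` and `Q` say whether it contains the larger,
respectively the smaller, of the two values. -/
def columnBr (P Q : ℕ → Bool) (j : ℕ) : List (Br × ℕ) :=
  if P j && !Q j then [(Br.op, j)] else if Q j && !P j then [(Br.cl, j)] else []

/-- If the columns satisfying `P` come first and carry the same tag, then the string of a block
of columns has the same effect as "(" for all `P` followed by ")" for all `Q`. -/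
theorem foldl_openStep_columnBr {σ : Type} (P Q : ℕ → Bool) (h : ℕ → σ) (s : σ) (L : List ℕ)
    (hP : L.Pairwise fun c c' => P c' → P c) (hs : ∀ c ∈ L, P c → h c = s) (ops : List σ) :
    ((L.flatMap (columnBr P Q)).map (Prod.map id h)).foldl openStep ops =
      List.dropLast^[L.countP Q] (ops ++ List.replicate (L.countP P) s) := by
  induction L generalizing ops with
  | nil => simp
  | cons c L ih =>
    rw [List.pairwise_cons] at hP
    have ih := ih hP.2 fun c hc => hs c (List.mem_cons_of_mem _ hc)
    have hc := hs c List.mem_cons_self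
    rw [List.flatMap_cons, List.map_append, List.foldl_append, ih, List.countP_cons,
      List.countP_cons]
    cases hPc : P c <;> cases hQc : Q c
    · simp [columnBr, hPc, hQc]
    · have h0 : L.countP P = 0 := by
        rw [List.countP_eq_zero]
        intro x hx hPx
        simpa [hPc] using hP.1 x hx hPx
      simp [columnBr, hPc, hQc, h0, openStep]
    · simp [columnBr, hPc, hQc, openStep, hc hPc, List.replicate_succ]
    · simp [columnBr, hPc, hQc, List.replicate_succ', ← List.append_assoc]

theorem colHasB_iff {μ : YoungDiagram} {f : ℕ → ℕ → ℕ} {j v : ℕ} :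
    colHasB μ f j v ↔ ∃ r, (r, j) ∈ μ ∧ f r j = v := by
  simp [colHasB, YoungDiagram.mem_iff_lt_colLen]

theorem tabString_eq (μ : YoungDiagram) (f : ℕ → ℕ → ℕ) (i : ℕ) :
    tabString μ f i = (List.range (μ.rowLen 0)).flatMap
      (columnBr (colHasB μ f · i) (colHasB μ f · (i - 1))) := rfl

open Classical in
theorem count_psiMS (μ : YoungDiagram) (f : ℕ → ℕ → ℕ) {a k : ℕ} (hak : a ≤ k) :
    (psiMS μ f).count (a, k) =
      ((Finset.range (μ.rowLen 0)).filter
        fun c => ∃ r, r + 1 = a ∧ (r, c) ∈ μ ∧ f r c = k).card := by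
  rw [psiMS, Multiset.count_map, Multiset.filter_filter]
  change (μ.cells.filter _).card = _
  refine Finset.card_bij (fun x _ => x.2) ?_ ?_ ?_
  · rintro ⟨r, c⟩ hx
    simp only [Finset.mem_filter, Prod.mk.injEq, Finset.mem_range, YoungDiagram.mem_cells] at hx ⊢
    refine ⟨?_, r, hx.2.1.1.symm, hx.1, hx.2.1.2.symm⟩
    exact YoungDiagram.mem_iff_lt_rowLen.1 (μ.up_left_mem (Nat.zero_le r) le_rfl hx.1)
  · rintro ⟨r, c⟩ hx ⟨r', c'⟩ hx' hcc
    simp only [Finset.mem_filter, Prod.mk.injEq] at hx hx' hcc ⊢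
    omega
  · intro c hc
    simp only [Finset.mem_filter] at hc
    obtain ⟨-, r, hr, hm, hk⟩ := hc
    refine ⟨(r, c), ?_, rfl⟩
    simp only [Finset.mem_filter, Prod.mk.injEq, YoungDiagram.mem_cells]
    exact ⟨hm, ⟨hr.symm, hk.symm⟩, by omega⟩

theorem List.countP_Ico (a b : ℕ) (P : ℕ → Bool) :
    (List.Ico a b).countP P = ((Finset.Ico a b).filter fun c => P c).card := by
  rw [List.countP_eq_length_filter, ← List.toFinset_card_of_nodup ((List.Ico.nodup a b).filter _),
    List.toFinset_filter]
  congr 2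
  ext c
  simp

namespace SemistandardYoungTableau

variable {μ : YoungDiagram} (T : SemistandardYoungTableau μ)

theorem entry_lt_of_lt {r r' c : ℕ} (h : r < r') (hm : (r', c) ∈ μ) :
    T.entry r c < T.entry r' c := T.col_strict h hm

theorem entry_le_of_le {r c c' : ℕ} (h : c ≤ c') (hm : (r, c') ∈ μ) :
    T.entry r c ≤ T.entry r c' := T.row_weak_of_le h hm

theorem le_entry {r c : ℕ} (hm : (r, c) ∈ μ) : r ≤ T.entry r c := by
  induction r with
  | zero => exact Nat.zero_le _
  | succ r ih =>
    exact (ih (μ.up_left_mem r.le_succ le_rfl hm)).trans_lt (T.entry_lt_of_lt r.lt_succ_self hm)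

/-- The cells of a semistandard tableau with entry less than `i` form a Young diagram. -/
def below (i : ℕ) : YoungDiagram where
  cells := μ.cells.filter fun x => T.entry x.1 x.2 < i
  isLowerSet := by
    rintro ⟨r, c⟩ ⟨r', c'⟩ hle hx
    have hle : r' ≤ r ∧ c' ≤ c := hle
    simp only [Finset.coe_filter, Set.mem_ofPred_eq, YoungDiagram.mem_cells] at hx ⊢
    refine ⟨μ.up_left_mem hle.1 hle.2 hx.1, ?_⟩
    have h1 := T.entry_le_of_le hle.2 hx.1
    have h2 : T.entry r' c' ≤ T.entry r c' :=
      T.col_weak hle.1 (μ.up_left_mem le_rfl hle.2 hx.1)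
    omega

theorem mem_below {i r c : ℕ} : (r, c) ∈ T.below i ↔ (r, c) ∈ μ ∧ T.entry r c < i := by
  rw [← YoungDiagram.mem_cells, below]
  simp

theorem colLen_below {i r c : ℕ} (hm : (r, c) ∈ μ) (hr : T.entry r c = i) :
    (T.below i).colLen c = r := by
  apply le_antisymm
  · by_contra! h
    have := (T.mem_below.1 (YoungDiagram.mem_iff_lt_colLen.2 h)).2
    omega
  · by_contra! h
    have h1 := T.entry_lt_of_lt h hm
    have h2 := T.mem_below.2 ⟨μ.up_left_mem h.le le_rfl hm, hr ▸ h1⟩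
    exact lt_irrefl _ (YoungDiagram.mem_iff_lt_colLen.1 h2)

/-- `T.cut i r` is the end of the block of columns in which an entry `i` has to lie in row `r`. -/
def cut (i : ℕ) : ℕ → ℕ
  | 0 => μ.rowLen 0
  | r + 1 => (T.below i).rowLen r

theorem lt_rowLen_zero_of_mem {r c : ℕ} (hm : (r, c) ∈ μ) : c < μ.rowLen 0 :=
  YoungDiagram.mem_iff_lt_rowLen.1 (μ.up_left_mem (Nat.zero_le r) le_rfl hm)

theorem cut_succ_le (i r : ℕ) : T.cut i (r + 1) ≤ T.cut i r := by
  cases r with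
  | zero =>
    by_contra! h
    exact lt_irrefl _
      (YoungDiagram.mem_iff_lt_rowLen.1 (T.mem_below.1 (YoungDiagram.mem_iff_lt_rowLen.2 h)).1)
  | succ r => exact (T.below i).rowLen_anti _ _ r.le_succ

theorem row_of_entry_eq {i r r' c : ℕ} (hc : T.cut i (r + 1) ≤ c) (hc' : c < T.cut i r)
    (hm : (r', c) ∈ μ) (h : T.entry r' c = i) : r' = r := by
  rw [← T.colLen_below hm h]
  apply le_antisymm
  · by_contra! hlt
    have := YoungDiagram.mem_iff_lt_rowLen.1 (YoungDiagram.mem_iff_lt_colLen.2 hlt)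
    simp only [cut] at hc
    omega
  · cases r with
    | zero => exact Nat.zero_le _
    | succ r => exact YoungDiagram.mem_iff_lt_colLen.1 (YoungDiagram.mem_iff_lt_rowLen.2 hc')

theorem row_of_entry_eq_pred {i r r' c : ℕ} (hi : 1 ≤ i) (hc : T.cut i (r + 1) ≤ c)
    (hc' : c < T.cut i r) (hm : (r', c) ∈ μ) (h : T.entry r' c = i - 1) : r' + 1 = r := by
  have hlt : r' < r := by
    by_contra! hle
    have h1 : (r, c) ∈ T.below i :=
      (T.below i).up_left_mem hle le_rfl (T.mem_below.2 ⟨hm, by omega⟩)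
    have := YoungDiagram.mem_iff_lt_rowLen.1 h1
    simp only [cut] at hc
    omega
  by_contra hne
  obtain ⟨m, rfl⟩ : ∃ m, r = m + 1 := ⟨r - 1, by omega⟩
  obtain ⟨h1, h2⟩ := T.mem_below.1 (YoungDiagram.mem_iff_lt_rowLen.2 hc')
  have := T.entry_lt_of_lt (show r' < m by omega) h1
  omega

theorem cut_le_of_entry_eq {i r c : ℕ} (hm : (r, c) ∈ μ) (h : T.entry r c = i) :
    T.cut i (r + 1) ≤ c ∧ c < T.cut i r := by
  constructor
  · by_contra! hlt
    have := (T.mem_below.1 (YoungDiagram.mem_iff_lt_rowLen.2 hlt)).2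
    omega
  · cases r with
    | zero => exact lt_rowLen_zero_of_mem hm
    | succ r =>
      refine YoungDiagram.mem_iff_lt_rowLen.1 (T.mem_below.2
        ⟨μ.up_left_mem r.le_succ le_rfl hm, ?_⟩)
      have := T.entry_lt_of_lt (Nat.lt_add_one r) hm
      omega

theorem cut_le_of_entry_eq_pred {i r c : ℕ} (hi : 1 ≤ i) (hm : (r, c) ∈ μ)
    (h : T.entry r c = i - 1) : T.cut i (r + 2) ≤ c ∧ c < T.cut i (r + 1) := by
  constructor
  · by_contra! hlt
    have h1 := T.mem_below.1 (YoungDiagram.mem_iff_lt_rowLen.2 hlt)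
    have := T.entry_lt_of_lt (Nat.lt_add_one r) h1.1
    omega
  · exact YoungDiagram.mem_iff_lt_rowLen.1 (T.mem_below.2 ⟨hm, by omega⟩)

theorem countP_colHasB {i r : ℕ} (hr : r < i) :
    (List.Ico (T.cut i (r + 1)) (T.cut i r)).countP (colHasB μ T.entry · i) =
      (psiMS μ T.entry).count (r + 1, i) := by
  rw [List.countP_Ico, count_psiMS _ _ (by omega)]
  refine congrArg Finset.card ?_
  ext c
  simp only [Finset.mem_filter, Finset.mem_Ico, Finset.mem_range, colHasB_iff]
  constructor
  · rintro ⟨⟨hc, hc'⟩, r', hm, h⟩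
    exact ⟨lt_rowLen_zero_of_mem hm, r', by rw [T.row_of_entry_eq hc hc' hm h], hm, h⟩
  · rintro ⟨-, r', hr', hm, h⟩
    obtain rfl : r' = r := by omega
    exact ⟨T.cut_le_of_entry_eq hm h, r', hm, h⟩

theorem countP_colHasB_pred {i r : ℕ} (hr : r < i) :
    (List.Ico (T.cut i (r + 1)) (T.cut i r)).countP (colHasB μ T.entry · (i - 1)) =
      (psiMS μ T.entry).count (r, i - 1) := by
  rw [List.countP_Ico, count_psiMS _ _ (by omega)]
  refine congrArg Finset.card ?_
  ext c
  simp only [Finset.mem_filter, Finset.mem_Ico, Finset.mem_range, colHasB_iff]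
  constructor
  · rintro ⟨⟨hc, hc'⟩, r', hm, h⟩
    exact ⟨lt_rowLen_zero_of_mem hm, r', T.row_of_entry_eq_pred (by omega) hc hc' hm h, hm, h⟩
  · rintro ⟨-, r', rfl, hm, h⟩
    exact ⟨T.cut_le_of_entry_eq_pred (by omega) hm h, r', hm, h⟩

theorem pairwise_colHasB (i r : ℕ) :
    (List.Ico (T.cut i (r + 1)) (T.cut i r)).Pairwise
      fun c c' => colHasB μ T.entry c' i → colHasB μ T.entry c i := by
  refine (List.Ico.pairwise_lt _ _).imp_of_mem ?_
  intro c c' hc hc' hlt h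
  rw [List.Ico.mem] at hc hc'
  rw [colHasB_iff] at h ⊢
  obtain ⟨r', hm, h⟩ := h
  obtain rfl := T.row_of_entry_eq hc'.1 hc'.2 hm h
  have hm' := μ.up_left_mem le_rfl hlt.le hm
  refine ⟨r', hm', le_antisymm (h ▸ T.entry_le_of_le hlt.le hm) ?_⟩
  by_contra! hlt'
  have := YoungDiagram.mem_iff_lt_rowLen.1 (T.mem_below.2 ⟨hm', hlt'⟩)
  simp only [cut] at hc
  omega

theorem foldl_openStep_cut (i : ℕ) (hi : 1 ≤ i) :
    (((List.range (T.cut i i)).flatMap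
      (columnBr (colHasB μ T.entry · i) (colHasB μ T.entry · (i - 1)))).foldl openStep []) = [] := by
  rw [List.eq_nil_iff_forall_not_mem]
  intro c hc
  rcases mem_of_mem_foldl_openStep hc with h | h
  · simp at h
  · obtain ⟨c', hc', h⟩ := List.mem_flatMap.1 h
    obtain ⟨m, rfl⟩ : ∃ m, i = m + 1 := ⟨i - 1, by omega⟩
    have hb := T.mem_below.1 (YoungDiagram.mem_iff_lt_rowLen.2 (List.mem_range.1 hc'))
    have hq : colHasB μ T.entry c' m :=
      colHasB_iff.2 ⟨m, hb.1, le_antisymm (by omega) (T.le_entry hb.1)⟩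
    simp only [columnBr, Nat.add_sub_cancel, hq] at h
    split_ifs at h <;> simp_all

/-- The uncanceled "(" of the tableau string and of the multisegment string correspond, each column
being sent to the segment of its entry `i`. -/
theorem map_scan_tabString (i : ℕ) (hi : 1 ≤ i) :
    (scan (tabString μ T.entry i)).2.map (fun c => ((T.below i).colLen c + 1, i)) =
      (scan (Si (psiMS μ T.entry) i)).2 := by
  rw [scan_snd, scan_snd, tabString_eq, Si]
  suffices h : ∀ t ≤ i,
      (((List.range (T.cut i (i - t))).flatMap (columnBr (colHasB μ T.entry · i)
        (colHasB μ T.entry · (i - 1)))).foldl openStep []).map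
          (fun c => ((T.below i).colLen c + 1, i)) =
      ((List.range t).flatMap fun t0 =>
        List.replicate ((psiMS μ T.entry).count (i - (t0 + 1) + 1, i))
          (Br.op, ((i - (t0 + 1) + 1 : ℕ), i)) ++
        List.replicate ((psiMS μ T.entry).count (i - (t0 + 1), i - 1))
          (Br.cl, ((i - (t0 + 1) : ℕ), i - 1))).foldl openStep [] by
    have h := h i le_rfl
    rw [Nat.sub_self] at h
    exact h
  intro t
  induction t with
  | zero => intro _; rw [Nat.sub_zero, T.foldl_openStep_cut i hi]; rfl
  | succ t ih =>
    intro ht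
    have ih := ih (by omega)
    obtain ⟨r, hr⟩ : ∃ r, i - t = r + 1 := ⟨i - t - 1, by omega⟩
    have hr' : i - (t + 1) = r := by omega
    rw [hr] at ih
    rw [hr', List.range_succ, List.flatMap_append, List.foldl_append, ← ih,
      List.flatMap_singleton, hr', foldl_openStep_replicate, ← List.Ico.zero_bot (T.cut i r),
      ← List.Ico.append_consecutive (Nat.zero_le _) (T.cut_succ_le i r), List.Ico.zero_bot,
      List.flatMap_append, List.foldl_append, map_foldl_openStep,
      foldl_openStep_columnBr _ _ _ (r + 1, i) _ (T.pairwise_colHasB i r),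
      T.countP_colHasB (by omega), T.countP_colHasB_pred (by omega)]
    intro c hc hP
    rw [List.Ico.mem] at hc
    obtain ⟨r', hm, h⟩ := colHasB_iff.1 hP
    obtain rfl := T.row_of_entry_eq hc.1 hc.2 hm h
    rw [T.colLen_below hm h]

end SemistandardYoungTableau

theorem colHasB_of_headOp_tabString {μ : YoungDiagram} {f : ℕ → ℕ → ℕ} {i j : ℕ}
    (h : headOp (tabString μ f i) = some j) :
    colHasB μ f j i ∧ ¬ colHasB μ f j (i - 1) := by
  have h1 := List.mem_of_mem_head? h
  rw [scan_snd] at h1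
  rcases mem_of_mem_foldl_openStep h1 with h2 | h2
  · simp at h2
  · rw [tabString_eq, List.mem_flatMap] at h2
    obtain ⟨c, -, hc⟩ := h2
    unfold columnBr at hc
    split_ifs at hc <;> simp_all

theorem stmt13 (n : ℕ) (μ : YoungDiagram) (T : SemistandardYoungTableau μ)
    (hT : ∀ r c : ℕ, (r, c) ∈ μ.cells → T.entry r c ≤ n)
    (i : ℕ) (hi : 1 ≤ i) (hin : i ≤ n)
    (g : ℕ → ℕ → ℕ) (hg : eTab μ T.entry i = some g) :
    eM i (psiMS μ T.entry) = some (psiMS μ g) := by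
  unfold eTab at hg
  split at hg
  · simp at hg
  rename_i j hj
  obtain ⟨hP, hQ⟩ := colHasB_of_headOp_tabString hj
  obtain ⟨r, hm, hr⟩ := colHasB_iff.1 hP
  have hri : r < i := by
    refine lt_of_le_of_ne (hr ▸ T.le_entry hm) ?_
    rintro rfl
    have hm' := μ.up_left_mem (Nat.sub_le r 1) le_rfl hm
    have h1 := T.entry_lt_of_lt (show r - 1 < r by omega) hm
    exact hQ (colHasB_iff.2 ⟨r - 1, hm', le_antisymm (by omega) (T.le_entry hm')⟩)
  have hhead : headOp (Si (psiMS μ T.entry) i) = some (r + 1, i) := by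
    rw [headOp, ← T.map_scan_tabString i hi, List.head?_map,
      show (scan (tabString μ T.entry i)).2.head? = some j from hj, Option.map_some,
      T.colLen_below hm hr]
  rw [Option.some.injEq] at hg
  obtain ⟨rest, hrest⟩ := Multiset.exists_cons_of_mem (show (r, j) ∈ μ.cells.val from hm)
  have hnd : (r, j) ∉ rest := by
    have := μ.cells.nodup
    rw [hrest, Multiset.nodup_cons] at this
    exact this.1
  have hgr : g r j = i - 1 := by
    rw [← hg]
    simp [hr, hm]
  have hgo : ∀ x ∈ rest, g x.1 x.2 = T.entry x.1 x.2 := by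
    rintro ⟨r', c⟩ hx
    rw [← hg]
    refine if_neg ?_
    rintro ⟨hc, h, hm'⟩
    obtain rfl : c = j := hc
    obtain rfl : r' = r := (T.colLen_below hm' h).symm.trans (T.colLen_below hm hr)
    exact hnd hx
  have hmap : (rest.filter fun x => x.1 + 1 ≤ g x.1 x.2).map (fun x => (x.1 + 1, g x.1 x.2)) =
      (rest.filter fun x => x.1 + 1 ≤ T.entry x.1 x.2).map
        (fun x => (x.1 + 1, T.entry x.1 x.2)) := by
    rw [Multiset.filter_congr fun x hx => by rw [hgo x hx]]
    exact Multiset.map_congr rfl fun x hx => by rw [hgo x (Multiset.mem_of_mem_filter hx)]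
  have hM : psiMS μ T.entry = (r + 1, i) ::ₘ (rest.filter fun x => x.1 + 1 ≤ T.entry x.1 x.2).map
      (fun x => (x.1 + 1, T.entry x.1 x.2)) := by
    rw [psiMS, hrest, Multiset.filter_cons_of_pos _ (by simpa [hr] using hri), Multiset.map_cons, hr]
  rw [eM, hhead, hM]
  simp only [Multiset.erase_cons_head, Option.some.injEq]
  rw [psiMS, hrest]
  split_ifs with h
  · rw [Multiset.filter_cons_of_neg _ (by simp only [hgr]; omega), hmap]
  · rw [Multiset.filter_cons_of_pos _ (by simp only [hgr]; omega), Multiset.map_cons, hmap, hgr,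
      add_comm, Multiset.singleton_add]
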